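/- arXiv:2407.00694 — 9 statements merged into one kernel-verified Lean document; each statement's English description precedes it below -/
import Mathlib

section
/- Let 𝓗 be a hypergraph on a finite vertex set V with |V| = n and let k ∈ ℕ. Then a subset of V of cardinality k is shattered by ext_k(𝓗) if and only if it is shattered by 𝓗. Consequently, if the VC-dimension of 𝓗 is strictly less than k, then the VC-dimension of ext_k(𝓗) is strictly less than k, and |ext_k(𝓗)| ≤ Σ_{i=0}^{k-1} C(n, i). -/
/-- A set `U` is shattered by the hypergraph (hyperedge family) `H` if every
subset of `U` is the trace of some hyperedge on `U`. -/
def Shatters {α : Type*} [DecidableEq α] (H : Finset (Finset α)) (U : Finset α) : Prop :=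
  ∀ U' ⊆ U, ∃ F ∈ H, F ∩ U = U'

/-- `extk V H k` is the family of all subsets of `V` that are `k`-compatible with `H`. -/
def extk {α : Type*} [DecidableEq α] (V : Finset α) (H : Finset (Finset α)) (k : ℕ) :
    Finset (Finset α) :=
  V.powerset.filter (fun E => ∀ S ∈ V.powerset, S.card = k → ∃ F ∈ H, E ∩ S = F ∩ S)

theorem Shatters.mono {α : Type*} [DecidableEq α] {H K : Finset (Finset α)} {U : Finset α}
    (h : Shatters H U) (hHK : H ⊆ K) : Shatters K U := fun U' hU' =>
  let ⟨F, hF, hFU⟩ := h U' hU'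
  ⟨F, hHK hF, hFU⟩

theorem Shatters.subset {α : Type*} [DecidableEq α] {H : Finset (Finset α)} {U W : Finset α}
    (h : Shatters H U) (hWU : W ⊆ U) : Shatters H W := by
  intro W' hW'
  obtain ⟨F, hF, hFU⟩ := h W' (hW'.trans hWU)
  refine ⟨F, hF, ?_⟩
  rw [← Finset.inter_eq_right.2 hWU, ← Finset.inter_assoc, hFU, Finset.inter_eq_left.2 hW']

theorem extk_subset {α : Type*} [DecidableEq α] {V E : Finset α} {H : Finset (Finset α)} {k : ℕ}
    (hE : E ∈ extk V H k) : E ⊆ V :=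
  Finset.mem_powerset.1 (Finset.mem_filter.1 hE).1

theorem subset_extk {α : Type*} [DecidableEq α] {V : Finset α} {H : Finset (Finset α)} {k : ℕ}
    (hH : ∀ F ∈ H, F ⊆ V) : H ⊆ extk V H k := fun F hF =>
  Finset.mem_filter.2 ⟨Finset.mem_powerset.2 (hH F hF), fun _ _ _ => ⟨F, hF, rfl⟩⟩

theorem Shatters.of_extk {α : Type*} [DecidableEq α] {V U : Finset α} {H : Finset (Finset α)}
    {k : ℕ} (hU : U ⊆ V) (hUk : U.card = k) (h : Shatters (extk V H k) U) : Shatters H U := by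
  intro U' hU'
  obtain ⟨E, hE, rfl⟩ := h U' hU'
  obtain ⟨F, hF, hEF⟩ := (Finset.mem_filter.1 hE).2 U (Finset.mem_powerset.2 hU) hUk
  exact ⟨F, hF, hEF.symm⟩

/-- The Sauer–Shelah bound for a family of subsets of `V` shattering only sets of size `< k`. -/
theorem card_le_sum_choose {α : Type*} [DecidableEq α] {V : Finset α} {H : Finset (Finset α)}
    {k : ℕ} (hH : ∀ F ∈ H, F ⊆ V) (hvc : ∀ U ⊆ V, Shatters H U → U.card < k) :
    H.card ≤ ∑ i ∈ Finset.range k, V.card.choose i := by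
  have hsub : H.shatterer ⊆ (Finset.range k).biUnion fun i => V.powersetCard i := by
    intro U hU
    have hU := Finset.mem_shatterer.1 hU
    have hUV : U ⊆ V := by
      obtain ⟨F, hF, hUF⟩ := hU Finset.Subset.rfl
      exact (Finset.inter_eq_left.1 hUF).trans (hH F hF)
    have hUH : Shatters H U := by
      intro U' hU'
      obtain ⟨F, hF, hUF⟩ := hU hU'
      exact ⟨F, hF, by rw [Finset.inter_comm, hUF]⟩
    exact Finset.mem_biUnion.2 ⟨U.card, Finset.mem_range.2 (hvc U hUV hUH),
      Finset.mem_powersetCard.2 ⟨hUV, rfl⟩⟩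
  calc H.card ≤ H.shatterer.card := Finset.card_le_card_shatterer H
    _ ≤ _ := Finset.card_le_card hsub
    _ ≤ ∑ i ∈ Finset.range k, (V.powersetCard i).card := Finset.card_biUnion_le
    _ = ∑ i ∈ Finset.range k, V.card.choose i := by simp only [Finset.card_powersetCard]

theorem stmt_0 {α : Type*} [DecidableEq α] (V : Finset α) (H : Finset (Finset α))
    (hH : ∀ F ∈ H, F ⊆ V) (n k : ℕ) (hn : V.card = n) :
    (∀ U ⊆ V, U.card = k → (Shatters (extk V H k) U ↔ Shatters H U)) ∧
      ((∀ U ⊆ V, Shatters H U → U.card < k) →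
        (∀ U ⊆ V, Shatters (extk V H k) U → U.card < k) ∧
          (extk V H k).card ≤ ∑ i ∈ Finset.range k, n.choose i) := by
  subst hn
  have key : ∀ U ⊆ V, U.card = k → (Shatters (extk V H k) U ↔ Shatters H U) :=
    fun U hU hUk => ⟨Shatters.of_extk hU hUk, fun h => h.mono (subset_extk hH)⟩
  refine ⟨key, fun hvc => ?_⟩
  have hext : ∀ U ⊆ V, Shatters (extk V H k) U → U.card < k := by
    intro U hU hsh
    by_contra! hk
    obtain ⟨W, hWU, hWk⟩ := Finset.exists_subset_card_eq hk
    have hWV := hWU.trans hU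
    exact (hvc W hWV ((key W hWV hWk).1 (hsh.subset hWU))).ne hWk
  exact ⟨hext, card_le_sum_choose (fun E hE => extk_subset hE) hext⟩
end

section
/- Let 𝓖 be a hypergraph on a finite vertex set V, let k ∈ ℕ, and let (T,S) be a k-trace on V. Set V' := V \ (S \ T) and let 𝓖' be the subhypergraph of 𝓖 induced by V'. Then there exists a minimal transversal E of 𝓖 with E ∩ S = T if and only if there exists a minimal transversal of 𝓖' that contains T. -/
/-- A transversal of a hyperedge family intersects every hyperedge. -/
def IsTransversal {α : Type*} [DecidableEq α] (H : Finset (Finset α)) (T : Finset α) : Prop :=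
  ∀ F ∈ H, (T ∩ F).Nonempty

/-- A minimal transversal of a hypergraph with vertex set `V` and hyperedge family `H`. -/
def IsMinTransversal {α : Type*} [DecidableEq α] (V : Finset α) (H : Finset (Finset α))
    (T : Finset α) : Prop :=
  T ⊆ V ∧ IsTransversal H T ∧ ∀ T' ⊂ T, ¬ IsTransversal H T'

/-- A subset of `W` is a transversal of the family induced on `W` exactly when it is a
transversal of the original family. -/
theorem isTransversal_image_inter_iff {α : Type*} [DecidableEq α] {G : Finset (Finset α)}
    {W X : Finset α} (hX : X ⊆ W) :
    IsTransversal (G.image (· ∩ W)) X ↔ IsTransversal G X := by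
  have h (F : Finset α) : X ∩ (F ∩ W) = X ∩ F := by
    rw [← Finset.inter_assoc,
      Finset.inter_eq_left.2 (Finset.inter_subset_left.trans hX)]
  simp only [IsTransversal, Finset.forall_mem_image, h]

/-- A subset of `W ⊆ V` is a minimal transversal of the hypergraph induced on `W` exactly when it
is a minimal transversal of the original hypergraph on `V`. -/
theorem isMinTransversal_image_inter_iff {α : Type*} [DecidableEq α] {V W : Finset α}
    {G : Finset (Finset α)} {E : Finset α} (hWV : W ⊆ V) :
    IsMinTransversal W (G.image (· ∩ W)) E ↔ IsMinTransversal V G E ∧ E ⊆ W := by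
  constructor
  · rintro ⟨hE, ht, hmin⟩
    exact ⟨⟨hE.trans hWV, (isTransversal_image_inter_iff hE).1 ht, fun X hX h =>
      hmin X hX ((isTransversal_image_inter_iff (hX.subset.trans hE)).2 h)⟩, hE⟩
  · rintro ⟨⟨-, ht, hmin⟩, hE⟩
    exact ⟨hE, (isTransversal_image_inter_iff hE).2 ht, fun X hX h =>
      hmin X hX ((isTransversal_image_inter_iff (hX.subset.trans hE)).1 h)⟩

theorem stmt_1 {α : Type*} [DecidableEq α] (V : Finset α) (G : Finset (Finset α))
    (hG : ∀ F ∈ G, F ⊆ V) (k : ℕ) (S T : Finset α)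
    (hSV : S ⊆ V) (hSk : S.card = k) (hTS : T ⊆ S) :
    (∃ E, IsMinTransversal V G E ∧ E ∩ S = T) ↔
      (∃ E, IsMinTransversal (V \ (S \ T)) (G.image (· ∩ (V \ (S \ T)))) E ∧ T ⊆ E) := by
  refine exists_congr fun E => ?_
  rw [isMinTransversal_image_inter_iff Finset.sdiff_subset, and_assoc]
  refine and_congr_right fun hE => ?_
  have hEV := hE.1
  constructor
  · rintro rfl
    exact ⟨fun x hx => by simp [hEV hx, hx], Finset.inter_subset_left⟩
  · rintro ⟨hEW, hTE⟩
    refine Finset.Subset.antisymm (fun x hx => ?_) (Finset.subset_inter hTE hTS)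
    obtain ⟨hxE, hxS⟩ := Finset.mem_inter.1 hx
    by_contra hxT
    exact (Finset.mem_sdiff.1 (hEW hxE)).2 (Finset.mem_sdiff.2 ⟨hxS, hxT⟩)
end

section
/- Let 𝓗 be a hypergraph on a finite vertex set V and let k ∈ ℕ with k ≤ |V|. If 𝓗 is k-conformal, then every set E ⊆ V that is k-compatible with 𝓗 is contained in some hyperedge of 𝓗. -/
theorem stmt_6 {α : Type*} [DecidableEq α] (V : Finset α) (H : Finset (Finset α))
    (hH : ∀ F ∈ H, F ⊆ V) (k : ℕ) (hk : k ≤ V.card)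
    (hconf : ∀ X ⊆ V, (∀ F ∈ H, ¬ X ⊆ F) → (∀ Y ⊂ X, ∃ F ∈ H, Y ⊆ F) → X.card ≤ k)
    (E : Finset α) (hE : E ⊆ V)
    (hcomp : ∀ S ⊆ V, S.card = k → ∃ F ∈ H, E ∩ S = F ∩ S) :
    ∃ F ∈ H, E ⊆ F := by
  suffices h : ∀ X ⊆ E, ∃ F ∈ H, X ⊆ F from h E subset_rfl
  intro X
  induction X using Finset.strongInduction with
  | H X ih =>
    intro hX
    by_contra! hno
    have hcard : X.card ≤ k :=
      hconf X (hX.trans hE) hno fun Y hY => ih Y hY (hY.subset.trans hX)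
    obtain ⟨S, hXS, hSV, hS⟩ := Finset.exists_subsuperset_card_eq (hX.trans hE) hcard hk
    obtain ⟨F, hF, hEF⟩ := hcomp S hSV hS
    have hXF : X ⊆ F ∩ S := hEF ▸ Finset.subset_inter hX hXS
    exact hno F hF (hXF.trans Finset.inter_subset_left)
end

section
/- Let 𝓗 be a hypergraph on a finite vertex set V having at least one hyperedge, and let X be a finite set disjoint from V. Let 𝓗̂ be the hypergraph on V ∪ X with hyperedge family {E ∪ X : E ∈ 𝓗}. Then a set T ⊆ V ∪ X is a minimal transversal of 𝓗̂ if and only if T is a minimal transversal of 𝓗 (in particular T ⊆ V) or T = {x} for some x ∈ X. -/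
theorem isTransversal_image_union_iff_of_disjoint {α : Type*} [DecidableEq α]
    {X T : Finset α} (H : Finset (Finset α)) (h : Disjoint T X) :
    IsTransversal (H.image (· ∪ X)) T ↔ IsTransversal H T := by
  simp [IsTransversal, Finset.inter_union_distrib_left, Finset.disjoint_iff_inter_eq_empty.mp h]

theorem isTransversal_image_union_of_mem {α : Type*} [DecidableEq α]
    {X T : Finset α} (H : Finset (Finset α)) {x : α} (hxT : x ∈ T) (hxX : x ∈ X) :
    IsTransversal (H.image (· ∪ X)) T := by
  intro F hF
  obtain ⟨E, -, rfl⟩ := Finset.mem_image.mp hF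
  exact ⟨x, Finset.mem_inter.mpr ⟨hxT, Finset.mem_union_right E hxX⟩⟩

theorem not_isTransversal_empty {α : Type*} [DecidableEq α]
    {H : Finset (Finset α)} (hH : H.Nonempty) : ¬ IsTransversal H ∅ := by
  obtain ⟨E, hE⟩ := hH
  intro h
  simpa using h E hE

theorem stmt_9 {α : Type*} [DecidableEq α] (V X : Finset α) (H : Finset (Finset α))
    (hH : ∀ F ∈ H, F ⊆ V) (hHne : H.Nonempty) (hdisj : Disjoint V X)
    (T : Finset α) (hT : T ⊆ V ∪ X) :
    IsMinTransversal (V ∪ X) (H.image (· ∪ X)) T ↔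
      (IsMinTransversal V H T ∨ ∃ x ∈ X, T = {x}) := by
  constructor
  · rintro ⟨-, htrans, hmin⟩
    by_cases hTX : Disjoint T X
    · refine Or.inl ⟨hTX.left_le_of_le_sup_right hT,
        (isTransversal_image_union_iff_of_disjoint H hTX).mp htrans, fun T' hT' h => ?_⟩
      exact hmin T' hT'
        ((isTransversal_image_union_iff_of_disjoint H (hTX.mono_left hT'.subset)).mpr h)
    · obtain ⟨x, hxT, hxX⟩ := Finset.not_disjoint_iff.mp hTX
      refine Or.inr ⟨x, hxX, ?_⟩
      by_contra hne
      exact hmin {x}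
        ((Finset.singleton_subset_iff.mpr hxT).ssubset_of_ne (Ne.symm hne))
        (isTransversal_image_union_of_mem H (Finset.mem_singleton_self x) hxX)
  · rintro (⟨hTV, htrans, hmin⟩ | ⟨x, hxX, rfl⟩)
    · have hTX : Disjoint T X := hdisj.mono_left hTV
      refine ⟨hT, (isTransversal_image_union_iff_of_disjoint H hTX).mpr htrans,
        fun T' hT' h => hmin T' hT' ?_⟩
      exact (isTransversal_image_union_iff_of_disjoint H (hTX.mono_left hT'.subset)).mp h
    · refine ⟨hT, isTransversal_image_union_of_mem H (Finset.mem_singleton_self x) hxX,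
        fun T' hT' => ?_⟩
      rw [Finset.ssubset_singleton_iff.mp hT']
      exact not_isTransversal_empty (hHne.image _)
end

section
/- Let 𝓗 be a hypergraph on a finite vertex set V with |V| = n, let k ∈ ℕ with 1 ≤ k ≤ n, and let x ∉ V. Let 𝓗̂_k be the hypergraph on V ∪ {x} whose hyperedge family is 𝓗 ∪ {X ∪ {x} : X ⊆ V, |X| = k}. Then for every T ⊆ V ∪ {x} with x ∈ T: T is a minimal transversal of 𝓗̂_k if and only if T ∖ {x} is a minimal transversal of 𝓗 and |T ∖ {x}| ≤ n − k. -/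
theorem isTransversal_sdiff_singleton {α : Type*} [DecidableEq α] {V : Finset α}
    {H : Finset (Finset α)} (hH : ∀ F ∈ H, F ⊆ V) {x : α} (hx : x ∉ V) {T : Finset α} :
    IsTransversal H (T \ {x}) ↔ IsTransversal H T := by
  refine forall₂_congr fun F hF => ?_
  have hxF : x ∉ F := fun h => hx (hH F hF h)
  rw [Finset.sdiff_inter_right_comm, Finset.sdiff_eq_self_of_disjoint]
  exact Finset.disjoint_singleton_right.2 fun h => hxF (Finset.mem_inter.1 h).2

/-- The `k`-subsets of `V` extended by a vertex `x` impose no condition on sets containing `x`,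
and on subsets of `V` they impose an upper bound on the size of the complement. -/
theorem isTransversal_union_image_iff {α : Type*} [DecidableEq α] {V : Finset α}
    {H : Finset (Finset α)} {k : ℕ} {x : α} {T : Finset α} :
    IsTransversal (H ∪ (V.powersetCard k).image (· ∪ {x})) T ↔
      IsTransversal H T ∧ (x ∈ T ∨ (V \ T).card < k) := by
  constructor
  · intro h
    refine ⟨fun F hF => h F (Finset.mem_union_left _ hF), ?_⟩
    by_contra! hc
    obtain ⟨X, hXs, hXk⟩ := Finset.exists_subset_card_eq hc.2
    obtain ⟨y, hy⟩ := h (X ∪ {x}) (Finset.mem_union_right _ (Finset.mem_image_of_mem _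
      (Finset.mem_powersetCard.2 ⟨hXs.trans Finset.sdiff_subset, hXk⟩)))
    obtain ⟨hyT, hyX⟩ := Finset.mem_inter.1 hy
    rcases Finset.mem_union.1 hyX with hyX | hyx
    · exact (Finset.mem_sdiff.1 (hXs hyX)).2 hyT
    · exact hc.1 (Finset.mem_singleton.1 hyx ▸ hyT)
  · rintro ⟨h, hx⟩ F hF
    rcases Finset.mem_union.1 hF with hF | hF
    · exact h F hF
    obtain ⟨X, hX, rfl⟩ := Finset.mem_image.1 hF
    obtain ⟨hXV, rfl⟩ := Finset.mem_powersetCard.1 hX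
    rcases hx with hx | hx
    · exact ⟨x, by simp [hx]⟩
    · by_contra hne
      refine hx.not_ge (Finset.card_le_card fun y hy => Finset.mem_sdiff.2 ⟨hXV hy, fun hyT => ?_⟩)
      exact hne ⟨y, by simp [hy, hyT]⟩

theorem stmt_10 {α : Type*} [DecidableEq α] (V : Finset α) (H : Finset (Finset α))
    (hH : ∀ F ∈ H, F ⊆ V) (n k : ℕ) (hn : V.card = n) (hk1 : 1 ≤ k) (hkn : k ≤ n)
    (x : α) (hx : x ∉ V) (T : Finset α) (hT : T ⊆ V ∪ {x}) (hxT : x ∈ T) :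
    IsMinTransversal (V ∪ {x}) (H ∪ (V.powersetCard k).image (· ∪ {x})) T ↔
      (IsMinTransversal V H (T \ {x}) ∧ (T \ {x}).card ≤ n - k) := by
  have hSV : T \ {x} ⊆ V := by
    rwa [sdiff_le_iff, Finset.sup_eq_union, Finset.union_comm]
  have hST : T \ {x} ⊂ T := Finset.sdiff_ssubset (by simpa using hxT) (by simp)
  have hcard : (V \ (T \ {x})).card = n - (T \ {x}).card := by
    rw [Finset.card_sdiff_of_subset hSV, hn]
  simp only [IsMinTransversal, isTransversal_union_image_iff]
  constructor
  · rintro ⟨-, ⟨hTH, -⟩, hmin⟩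
    have hS := (isTransversal_sdiff_singleton hH hx).2 hTH
    refine ⟨⟨hSV, hS, fun S' hS' hS'H => ?_⟩, ?_⟩
    · have hsub : insert x S' ⊂ T := by
        rw [Finset.ssubset_iff_subset_ne]
        refine ⟨Finset.insert_subset hxT (hS'.1.trans Finset.sdiff_subset), ?_⟩
        rintro rfl
        exact hS'.2 fun y hy => by simp at hy; tauto
      refine hmin _ hsub ⟨?_, Or.inl (Finset.mem_insert_self x S')⟩
      exact fun F hF => (hS'H F hF).mono
        (Finset.inter_subset_inter_right (Finset.subset_insert x S'))
    · have := hmin _ hST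
      have : ¬ (V \ (T \ {x})).card < k := fun h => this ⟨hS, Or.inr h⟩
      omega
  · rintro ⟨⟨-, hS, hmin⟩, hle⟩
    refine ⟨hT, ⟨(isTransversal_sdiff_singleton hH hx).1 hS, Or.inl hxT⟩, ?_⟩
    rintro T' hT' ⟨hT'H, hx'⟩
    have hT'S : T' \ {x} ⊆ T \ {x} := Finset.sdiff_subset_sdiff hT'.1 subset_rfl
    have heq : T' \ {x} = T \ {x} := by
      by_contra hne
      exact hmin _ (Finset.ssubset_iff_subset_ne.2 ⟨hT'S, hne⟩)
        ((isTransversal_sdiff_singleton hH hx).2 hT'H)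
    by_cases hxT' : x ∈ T'
    · refine hT'.ne ?_
      rw [← Finset.sdiff_union_of_subset (Finset.singleton_subset_iff.2 hxT'), heq,
        Finset.sdiff_union_of_subset (Finset.singleton_subset_iff.2 hxT)]
    · rw [Finset.sdiff_eq_self_of_disjoint (Finset.disjoint_singleton_right.2 hxT')] at heq
      have hlt := hx'.resolve_left hxT'
      rw [heq] at hlt
      omega
end

section
/- Let 𝓗 be a hypergraph on a finite vertex set V with |V| ≥ k, let ℓ, k ∈ ℕ with 1 ≤ ℓ ≤ k, and let x ∉ V. Let 𝓗̂_ℓ be the hypergraph on V ∪ {x} whose hyperedge family is 𝓗 ∪ {X ∪ {x} : X ⊆ V, |X| = ℓ}. Then for every U ⊆ V ∪ {x} with |U| = k, the family {F ∩ U : F a hyperedge of 𝓗̂_ℓ} contains at least C(k−1, ℓ−1) distinct sets of cardinality ℓ. Consequently, if 𝓕 is a hypergraph on k vertices having strictly fewer than C(k−1, ℓ−1) hyperedges of cardinality ℓ, then no subhypergraph of 𝓗̂_ℓ induced by a k-element vertex subset is isomorphic to 𝓕. -/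
/-- Every `k`-set `U ⊆ V ∪ {x}` meets the sets `X ∪ {x}`, with `X` an `l`-subset of `V`, in at least
`(k - 1).choose (l - 1)` distinct sets of cardinality `l`. -/
theorem choose_le_card_trace {α : Type*} [DecidableEq α] {V U : Finset α} {H : Finset (Finset α)}
    {k l : ℕ} {x : α} (hkV : k ≤ V.card) (hl1 : 1 ≤ l) (hlk : l ≤ k)
    (hU : U ⊆ V ∪ {x}) (hUk : U.card = k) :
    Nat.choose (k - 1) (l - 1) ≤
      (((H ∪ (V.powersetCard l).image (· ∪ {x})).image (· ∩ U)).filter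
        (fun A => A.card = l)).card := by
  by_cases hxU : x ∈ U
  · have hcard : (U.erase x).card = k - 1 := by rw [Finset.card_erase_of_mem hxU, hUk]
    obtain ⟨y, hyV, hyU⟩ : ∃ y ∈ V, y ∉ U.erase x :=
      Finset.exists_mem_notMem_of_card_lt_card (by omega)
    rw [← hcard, ← Finset.card_powersetCard]
    refine Finset.card_le_card_of_injOn (insert x) ?_ ?_
    · intro S hS
      obtain ⟨hSU, hSl⟩ := Finset.mem_powersetCard.1 hS
      have hxS : x ∉ S := fun h => by simpa using hSU h
      have hyS : y ∉ S := fun h => hyU (hSU h)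
      have hSV : S ⊆ V := fun a ha => by
        have := hSU ha
        have := @hU a
        grind
      refine Finset.mem_coe.2 (Finset.mem_filter.2 ⟨Finset.mem_image.2
        ⟨insert y S ∪ {x}, Finset.mem_union_right _ (Finset.mem_image.2
          ⟨insert y S, Finset.mem_powersetCard.2 ⟨?_, ?_⟩, rfl⟩), ?_⟩, ?_⟩)
      · exact Finset.insert_subset hyV hSV
      · rw [Finset.card_insert_of_notMem hyS]; omega
      · ext a
        have := @hSU a
        grind
      · rw [Finset.card_insert_of_notMem hxS]; omega
    · intro S hS T hT h
      have hxS : x ∉ S := fun h => by simpa using (Finset.mem_powersetCard.1 hS).1 h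
      have hxT : x ∉ T := fun h => by simpa using (Finset.mem_powersetCard.1 hT).1 h
      rw [← Finset.erase_insert hxS, ← Finset.erase_insert hxT]
      exact congrArg (Finset.erase · x) h
  · have hchoose : Nat.choose (k - 1) (l - 1) ≤ Nat.choose k l := by
      obtain ⟨k, rfl⟩ : ∃ m, k = m + 1 := ⟨k - 1, by omega⟩
      obtain ⟨l, rfl⟩ : ∃ m, l = m + 1 := ⟨l - 1, by omega⟩
      simp [Nat.choose_succ_succ]
    refine hchoose.trans ?_
    rw [← hUk, ← Finset.card_powersetCard]
    refine Finset.card_le_card fun S hS => ?_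
    obtain ⟨hSU, hSl⟩ := Finset.mem_powersetCard.1 hS
    refine Finset.mem_filter.2 ⟨Finset.mem_image.2
      ⟨S ∪ {x}, Finset.mem_union_right _ (Finset.mem_image.2
        ⟨S, Finset.mem_powersetCard.2 ⟨fun a ha => ?_, hSl⟩, rfl⟩), ?_⟩, hSl⟩
    · have := hSU ha
      have := @hU a
      grind
    · ext a
      have := @hSU a
      grind

/-- A map injective on `U` preserves the number of `l`-sets in a family of subsets of `U`. -/
theorem card_filter_card_le_of_image {α β : Type*} [DecidableEq α] [DecidableEq β]
    {U : Finset α} {G : Finset (Finset α)} (hG : ∀ A ∈ G, A ⊆ U) {f : α → β}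
    (hf : Set.InjOn f ↑U) (l : ℕ) :
    (G.filter (fun A => A.card = l)).card ≤
      ((G.image (Finset.image f)).filter (fun A => A.card = l)).card := by
  refine Finset.card_le_card_of_injOn (Finset.image f) ?_ ?_
  · intro A hA
    obtain ⟨hAG, hAl⟩ := Finset.mem_filter.1 hA
    refine Finset.mem_coe.2 (Finset.mem_filter.2 ⟨Finset.mem_image_of_mem _ hAG, ?_⟩)
    rw [Finset.card_image_of_injOn (hf.mono (Finset.coe_subset.2 (hG A hAG))), hAl]
  · intro A hA B hB h
    have hAU := Finset.coe_subset.2 (hG A (Finset.mem_filter.1 hA).1)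
    have hBU := Finset.coe_subset.2 (hG B (Finset.mem_filter.1 hB).1)
    apply Finset.coe_injective
    rw [← hf.image_eq_image_iff hAU hBU, ← Finset.coe_image, ← Finset.coe_image]
    exact congrArg _ h

theorem stmt_14 {α β : Type*} [DecidableEq α] [DecidableEq β]
    (V : Finset α) (H : Finset (Finset α)) (hH : ∀ F ∈ H, F ⊆ V)
    (k l : ℕ) (hkV : k ≤ V.card) (hl1 : 1 ≤ l) (hlk : l ≤ k)
    (x : α) (hx : x ∉ V) :
    (∀ U ⊆ V ∪ {x}, U.card = k →
      Nat.choose (k - 1) (l - 1) ≤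
        (((H ∪ (V.powersetCard l).image (· ∪ {x})).image (· ∩ U)).filter
          (fun A => A.card = l)).card) ∧
      ∀ (VF : Finset β) (F : Finset (Finset β)), VF.card = k → (∀ e ∈ F, e ⊆ VF) →
        (F.filter (fun A => A.card = l)).card < Nat.choose (k - 1) (l - 1) →
        ∀ U ⊆ V ∪ {x}, U.card = k →
          ¬ ∃ f : α → β, Set.InjOn f ↑U ∧ U.image f = VF ∧
              ((H ∪ (V.powersetCard l).image (· ∪ {x})).image (· ∩ U)).image
                  (Finset.image f) = F := by
  refine ⟨fun U hU hUk => choose_le_card_trace hkV hl1 hlk hU hUk, ?_⟩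
  rintro VF F - - hlt U hU hUk ⟨f, hf, -, rfl⟩
  refine hlt.not_ge ((choose_le_card_trace hkV hl1 hlk hU hUk).trans
    (card_filter_card_le_of_image (fun A hA => ?_) hf l))
  obtain ⟨B, -, rfl⟩ := Finset.mem_image.1 hA
  exact Finset.inter_subset_right
end

section
/- Let 𝓗 and 𝓖 be hypergraphs on a common finite vertex set V and let k ∈ ℕ. Assume that every hyperedge of 𝓗 is a minimal transversal of 𝓖. Then the set of minimal transversals of 𝓖 is exactly the hyperedge family of 𝓗 if and only if both of the following hold: (a) for every S ⊆ V with |S| = k and every T ⊆ S such that no hyperedge F of 𝓗 satisfies F ∩ S = T, there is no minimal transversal E of 𝓖 with E ∩ S = T; and (b) no set E ⊆ V that is k-compatible with 𝓗 and is contained in no hyperedge of 𝓗 is a minimal transversal of 𝓖. -/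
theorem stmt_15 {α : Type*} [DecidableEq α] (V : Finset α) (H G : Finset (Finset α))
    (hH : ∀ F ∈ H, F ⊆ V) (hG : ∀ F ∈ G, F ⊆ V) (k : ℕ)
    (hmin : ∀ F ∈ H, IsMinTransversal V G F) :
    (∀ E, IsMinTransversal V G E ↔ E ∈ H) ↔
      ((∀ S ⊆ V, S.card = k → ∀ T ⊆ S, (∀ F ∈ H, F ∩ S ≠ T) →
          ¬ ∃ E, IsMinTransversal V G E ∧ E ∩ S = T) ∧
        (∀ E ⊆ V, (∀ S ⊆ V, S.card = k → ∃ F ∈ H, E ∩ S = F ∩ S) →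
          (∀ F ∈ H, ¬ E ⊆ F) → ¬ IsMinTransversal V G E)) := by
  constructor
  · intro h
    refine ⟨?_, fun E _ _ hE hEmin => hE E ((h E).1 hEmin) subset_rfl⟩
    rintro S _ _ T _ hT ⟨E, hE, hES⟩
    exact hT E ((h E).1 hE) hES
  · rintro ⟨ha, hb⟩ E
    refine ⟨fun hE => ?_, hmin E⟩
    obtain ⟨F, hF, hEF⟩ : ∃ F ∈ H, E ⊆ F := by
      by_contra! hnot
      refine hb E hE.1 (fun S hS hcard => ?_) hnot hE
      by_contra! hS'
      exact ha S hS hcard (E ∩ S) Finset.inter_subset_right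
        (fun F hF => (hS' F hF).symm) ⟨E, hE, rfl⟩
    rcases hEF.eq_or_ssubset with rfl | hlt
    · exact hF
    · exact absurd hE.2.1 ((hmin F hF).2.2 E hlt)
end

section
/- Let 𝓗 and 𝓖 be hypergraphs on a common finite vertex set V. Assume 𝓗 is Sperner (no hyperedge of 𝓗 strictly contains another hyperedge of 𝓗), let E be a hyperedge of 𝓗, let x ∈ E, and suppose E ∖ {x} is a transversal of 𝓖. Then (V ∖ E) ∪ {x} is a transversal of 𝓗, and every minimal transversal T of 𝓗 with T ⊆ (V ∖ E) ∪ {x} is not a hyperedge of 𝓖. -/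
theorem stmt_16 {α : Type*} [DecidableEq α] (V : Finset α) (H G : Finset (Finset α))
    (hH : ∀ F ∈ H, F ⊆ V) (hG : ∀ F ∈ G, F ⊆ V)
    (hSperner : ∀ F₁ ∈ H, ∀ F₂ ∈ H, F₁ ⊆ F₂ → F₁ = F₂)
    (E : Finset α) (hE : E ∈ H) (x : α) (hx : x ∈ E)
    (htr : IsTransversal G (E \ {x})) :
    IsTransversal H ((V \ E) ∪ {x}) ∧
      ∀ T, IsMinTransversal V H T → T ⊆ (V \ E) ∪ {x} → T ∉ G := by
  refine ⟨fun F hF => ?_, fun T _ hTE hTG => ?_⟩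
  · by_cases hFE : F ⊆ E
    · obtain rfl := hSperner F hF E hE hFE
      exact ⟨x, by simp [hx]⟩
    · obtain ⟨y, hyF, hyE⟩ := Finset.not_subset.mp hFE
      exact ⟨y, by simp [hyF, hyE, hH F hF hyF]⟩
  · obtain ⟨y, hy⟩ := htr T hTG
    simp only [Finset.mem_inter, Finset.mem_sdiff, Finset.mem_singleton] at hy
    have hyT := hTE hy.2
    simp [hy.1.1, hy.1.2] at hyT
end

section
/- Let 𝓗 and 𝓖 be hypergraphs on a common finite vertex set V. Assume that every hyperedge of 𝓗 is a minimal transversal of 𝓖, and let E be a minimal transversal of 𝓖 that is not a hyperedge of 𝓗. Then V ∖ E is a transversal of 𝓗, and every minimal transversal E' of 𝓗 with E' ⊆ V ∖ E is not a hyperedge of 𝓖. -/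
theorem stmt_17 {α : Type*} [DecidableEq α] (V : Finset α) (H G : Finset (Finset α))
    (hH : ∀ F ∈ H, F ⊆ V) (hG : ∀ F ∈ G, F ⊆ V)
    (hmin : ∀ F ∈ H, IsMinTransversal V G F)
    (E : Finset α) (hE : IsMinTransversal V G E) (hEH : E ∉ H) :
    IsTransversal H (V \ E) ∧
      ∀ E', IsMinTransversal V H E' → E' ⊆ V \ E → E' ∉ G := by
  refine ⟨fun F hF => ?_, fun E' _ hE'sub hE'G => ?_⟩
  · by_contra hne
    have hFE : F ⊆ E := by
      intro x hx
      by_contra hxE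
      exact hne ⟨x, Finset.mem_inter.2 ⟨Finset.mem_sdiff.2 ⟨hH F hF hx, hxE⟩, hx⟩⟩
    have hFneE : F ≠ E := fun h => hEH (h ▸ hF)
    exact hE.2.2 F (Finset.ssubset_iff_subset_ne.2 ⟨hFE, hFneE⟩) (hmin F hF).2.1
  · obtain ⟨x, hx⟩ := hE.2.1 E' hE'G
    obtain ⟨hxE, hxE'⟩ := Finset.mem_inter.1 hx
    exact (Finset.mem_sdiff.1 (hE'sub hxE')).2 hxE
end
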